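/- For real z, the 4×4 Hermitian matrix E(z) with rows [4z²−4z, −z²+2z+2, −z³+4z²−2z+2, −z³+3z²+3z−2], [−z²+2z+2, −2z³+4z²+2z−4, 2z²−z+2, 5z²−4z+2], [−z³+4z²−2z+2, 2z²−z+2, 2z²+2z−4, −z³+2z²+2], [−z³+3z²+3z−2, 5z²−4z+2, −z³+2z²+2, 0] has characteristic polynomial (x − λ₀)²(x − λ₁)(x − λ₂), where λ₀ = z³ − z² + 3z − 6, λ₁ = −2z³ + 10z² − z + 2, and λ₂ = −2z³ + 2z² − 5z + 2. -/

import Mathlib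

open Polynomial

/-- The Hermitian (real symmetric) matrix `E(z)`. -/
noncomputable def E (z : ℝ) : Matrix (Fin 4) (Fin 4) ℝ :=
  !![4*z^2 - 4*z,               -z^2 + 2*z + 2,            -z^3 + 4*z^2 - 2*z + 2,  -z^3 + 3*z^2 + 3*z - 2;
     -z^2 + 2*z + 2,            -2*z^3 + 4*z^2 + 2*z - 4,  2*z^2 - z + 2,           5*z^2 - 4*z + 2;
     -z^3 + 4*z^2 - 2*z + 2,    2*z^2 - z + 2,             2*z^2 + 2*z - 4,         -z^3 + 2*z^2 + 2;
     -z^3 + 3*z^2 + 3*z - 2,    5*z^2 - 4*z + 2,           -z^3 + 2*z^2 + 2,        0]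

theorem charpoly_E (z : ℝ) :
    (E z).charpoly =
      (X - C (z^3 - z^2 + 3*z - 6))^2 *
      (X - C (-2*z^3 + 10*z^2 - z + 2)) *
      (X - C (-2*z^3 + 2*z^2 - 5*z + 2)) := by
  refine Polynomial.funext fun x => ?_
  rw [Matrix.eval_charpoly, E, Matrix.det_succ_row_zero]
  simp [Fin.sum_univ_succ, Matrix.det_fin_three, Matrix.scalar_apply, Fin.succAbove,
    Matrix.diagonal_apply]
  ring
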